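/- arXiv:solv-int/9803004 — 4 statements merged into one kernel-verified Lean document; each statement's English description precedes it below -/
import Mathlib

section
/- Let U ⊆ ℝ³ be an open set on which the three coordinates are pairwise distinct (x ≠ y, y ≠ z, x ≠ z at every point). Let χ : U → ℝ be twice continuously differentiable and satisfy the Darboux linear system: ∂²χ/∂z∂y + (1/(2(z−y)))(∂χ/∂z − ∂χ/∂y) = 0, ∂²χ/∂z∂x + (1/(2(z−x)))(∂χ/∂z − ∂χ/∂x) = 0, ∂²χ/∂x∂y + (1/(2(x−y)))(∂χ/∂x − ∂χ/∂y) = 0 on U. Let φ : U → ℝ be twice continuously differentiable and satisfy the first-order relations ∂φ/∂x = χ/2 − x·∂χ/∂x, ∂φ/∂y = χ/2 − y·∂χ/∂y, ∂φ/∂z = χ/2 − z·∂χ/∂z on U. Then φ also satisfies the Darboux linear system on U. -/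
/-- Partial derivative of `f : ℝ³ → ℝ` in the `i`-th coordinate direction. -/
noncomputable def pd (i : Fin 3) (f : (Fin 3 → ℝ) → ℝ) (p : Fin 3 → ℝ) : ℝ :=
  fderiv ℝ f p (Pi.single i 1)

/-- The Darboux linear system for a function `Φ` of three real variables `(x,y,z) = (p 0, p 1, p 2)`:
`Φ_{zy} + (1/(2(z−y)))(Φ_z − Φ_y) = 0`, `Φ_{zx} + (1/(2(z−x)))(Φ_z − Φ_x) = 0`,
`Φ_{xy} + (1/(2(x−y)))(Φ_x − Φ_y) = 0` on `U`. -/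
def DarbouxSystem (Φ : (Fin 3 → ℝ) → ℝ) (U : Set (Fin 3 → ℝ)) : Prop :=
  ∀ p ∈ U,
    pd 2 (pd 1 Φ) p + (1 / (2 * (p 2 - p 1))) * (pd 2 Φ p - pd 1 Φ p) = 0 ∧
    pd 2 (pd 0 Φ) p + (1 / (2 * (p 2 - p 0))) * (pd 2 Φ p - pd 0 Φ p) = 0 ∧
    pd 0 (pd 1 Φ) p + (1 / (2 * (p 0 - p 1))) * (pd 0 Φ p - pd 1 Φ p) = 0

theorem pd_pd_aux (U : Set (Fin 3 → ℝ)) (hU : IsOpen U) (χ φ : (Fin 3 → ℝ) → ℝ)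
    (hχ : ContDiffOn ℝ 2 χ U)
    (hrel : ∀ p ∈ U, ∀ i : Fin 3, pd i φ p = χ p / 2 - p i * pd i χ p)
    (p : Fin 3 → ℝ) (hp : p ∈ U) (i j : Fin 3) (hij : j ≠ i) :
    pd i (pd j φ) p = pd i χ p / 2 - p j * pd i (pd j χ) p := by
  have hc : ContDiffAt ℝ 2 χ p := hχ.contDiffAt (hU.mem_nhds hp)
  have h1 : HasFDerivAt χ (fderiv ℝ χ p) p := (hc.differentiableAt (by norm_num)).hasFDerivAt
  have h2 : DifferentiableAt ℝ (pd j χ) p := by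
    have h3 : DifferentiableAt ℝ (fderiv ℝ χ) p :=
      (hc.fderiv_right (m := 1) (by norm_num)).differentiableAt (by norm_num)
    exact h3.clm_apply (differentiableAt_const _)
  have h4 : HasFDerivAt (fun q : Fin 3 → ℝ => q j) (ContinuousLinearMap.proj (R := ℝ) (φ := fun _ : Fin 3 => ℝ) j) p :=
    hasFDerivAt_apply j p
  have h5 := (h1.const_mul (1 / 2 : ℝ)).sub (h4.mul h2.hasFDerivAt)
  have h6 : pd j φ =ᶠ[nhds p] fun q => (1 / 2 : ℝ) * χ q - q j * pd j χ q := by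
    filter_upwards [hU.mem_nhds hp] with q hq
    rw [hrel q hq j]; ring
  have h7 := (h5.congr_of_eventuallyEq h6).fderiv
  have h8 : pd i (pd j φ) p = fderiv ℝ (pd j φ) p (Pi.single i 1) := rfl
  rw [h8, h7]
  simp [hij, pd]
  ring

/-- If `χ` is a `C²` solution of the Darboux linear system on an open set `U` where the three
coordinates are pairwise distinct, and the `C²` function `φ` satisfies
`∂φ/∂u_i = χ/2 − u_i ∂χ/∂u_i`, then `φ` is again a solution of the Darboux linear system. -/
theorem darboux_recursion
    (U : Set (Fin 3 → ℝ)) (hU : IsOpen U)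
    (hdist : ∀ p ∈ U, p 0 ≠ p 1 ∧ p 1 ≠ p 2 ∧ p 0 ≠ p 2)
    (χ φ : (Fin 3 → ℝ) → ℝ)
    (hχ : ContDiffOn ℝ 2 χ U) (hφ : ContDiffOn ℝ 2 φ U)
    (hχD : DarbouxSystem χ U)
    (hrel : ∀ p ∈ U, ∀ i : Fin 3, pd i φ p = χ p / 2 - p i * pd i χ p) :
    DarbouxSystem φ U := by
  intro p hp
  obtain ⟨d1, d2, d3⟩ := hdist p hp
  obtain ⟨e1, e2, e3⟩ := hχD p hp
  have aux := pd_pd_aux U hU χ φ hχ hrel p hp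
  have key : ∀ x y a b c : ℝ, x ≠ y → c + 1 / (2 * (x - y)) * (a - b) = 0 →
      a / 2 - y * c + 1 / (2 * (x - y)) * ((χ p / 2 - x * a) - (χ p / 2 - y * b)) = 0 := by
    intro x y a b c hxy h
    have hne : x - y ≠ 0 := sub_ne_zero.mpr hxy
    have hc : c = -(1 / (2 * (x - y)) * (a - b)) := by linarith
    rw [hc]
    field_simp
    ring
  rw [aux 2 1 (by decide), aux 2 0 (by decide), aux 0 1 (by decide),
    hrel p hp 0, hrel p hp 1, hrel p hp 2]
  exact ⟨key _ _ _ _ _ d2.symm e1, key _ _ _ _ _ d3.symm e2, key _ _ _ _ _ d1 e3⟩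
end

section
/- Let U ⊆ ℝ³ be open (coordinates (x,y,z)) and let A, B : U → ℝ be twice continuously differentiable with A and B nowhere zero and ∂A/∂y nowhere zero on U. Let K₁, K₂ : U → ℝ be twice continuously differentiable with K₁(p) ≠ K₂(p) for all p ∈ U, and suppose the relations ∂K₁/∂y = (K₂ − K₁)·(A_y/A) and ∂K₂/∂x = (K₁ − K₂)·(B_x/B) hold on U. Then K₁ satisfies on U the second-order equation: K_{1xy} + (A_y/A)·K_{1x} + (B_x/B + A_x/A − A_{xy}/A_y)·K_{1y} = 0. -/
theorem pd_diff {U : Set (Fin 3 → ℝ)} (hU : IsOpen U) {f : (Fin 3 → ℝ) → ℝ}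
    (hf : ContDiffOn ℝ 2 f U) (i : Fin 3) {p : Fin 3 → ℝ} (hp : p ∈ U) :
    DifferentiableAt ℝ (pd i f) p := by
  have h : ContDiffAt ℝ 2 f p := hf.contDiffAt (hU.mem_nhds hp)
  have h1 : ContDiffAt ℝ 1 (fderiv ℝ f) p := h.fderiv_right (by norm_num)
  have h2 : DifferentiableAt ℝ (fderiv ℝ f) p := h1.differentiableAt (by norm_num)
  exact h2.clm_apply (differentiableAt_const _)

theorem pd_mul {f g : (Fin 3 → ℝ) → ℝ} {p : Fin 3 → ℝ} (i : Fin 3)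
    (hf : DifferentiableAt ℝ f p) (hg : DifferentiableAt ℝ g p) :
    pd i (fun q => f q * g q) p = f p * pd i g p + g p * pd i f p := by
  unfold pd
  rw [fderiv_fun_mul hf hg]
  simp

theorem pd_sub {f g : (Fin 3 → ℝ) → ℝ} {p : Fin 3 → ℝ} (i : Fin 3)
    (hf : DifferentiableAt ℝ f p) (hg : DifferentiableAt ℝ g p) :
    pd i (fun q => f q - g q) p = pd i f p - pd i g p := by
  unfold pd
  rw [fderiv_fun_sub hf hg]
  simp

/-- From the relations `K_{1y} = (K₂−K₁)·A_y/A` and `K_{2x} = (K₁−K₂)·B_x/B` the principal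
curvature `K₁` satisfies the Laplace-type equation
`K_{1xy} + (A_y/A)K_{1x} + (B_x/B + A_x/A − A_{xy}/A_y)K_{1y} = 0`.
Coordinates: `x = p 0`, `y = p 1`, `z = p 2`. -/
theorem principal_curvature_laplace_equation
    (U : Set (Fin 3 → ℝ)) (hU : IsOpen U)
    (A B K₁ K₂ : (Fin 3 → ℝ) → ℝ)
    (hA : ContDiffOn ℝ 2 A U) (hB : ContDiffOn ℝ 2 B U)
    (hK₁ : ContDiffOn ℝ 2 K₁ U) (hK₂ : ContDiffOn ℝ 2 K₂ U)
    (hA0 : ∀ p ∈ U, A p ≠ 0) (hB0 : ∀ p ∈ U, B p ≠ 0)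
    (hAy : ∀ p ∈ U, pd 1 A p ≠ 0)
    (hK : ∀ p ∈ U, K₁ p ≠ K₂ p)
    (hrel1 : ∀ p ∈ U, pd 1 K₁ p = (K₂ p - K₁ p) * (pd 1 A p / A p))
    (hrel2 : ∀ p ∈ U, pd 0 K₂ p = (K₁ p - K₂ p) * (pd 0 B p / B p)) :
    ∀ p ∈ U,
      pd 0 (pd 1 K₁) p + (pd 1 A p / A p) * pd 0 K₁ p
        + (pd 0 B p / B p + pd 0 A p / A p - pd 0 (pd 1 A) p / pd 1 A p) * pd 1 K₁ p = 0 := by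
  intro p hp
  have d : ∀ {f : (Fin 3 → ℝ) → ℝ}, ContDiffOn ℝ 2 f U → DifferentiableAt ℝ f p := fun hf =>
    (hf.contDiffAt (hU.mem_nhds hp)).differentiableAt (by norm_num)
  have e : (fun q => pd 1 K₁ q * A q) =ᶠ[nhds p] (fun q => (K₂ q - K₁ q) * pd 1 A q) := by
    filter_upwards [hU.mem_nhds hp] with q hq
    rw [hrel1 q hq]
    field_simp [hA0 q hq]
  have e2 : pd 0 (fun q => pd 1 K₁ q * A q) p = pd 0 (fun q => (K₂ q - K₁ q) * pd 1 A q) p := by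
    unfold pd at e ⊢
    rw [e.fderiv_eq]
  rw [pd_mul 0 (pd_diff hU hK₁ 1 hp) (d hA),
    pd_mul 0 ((d hK₂).fun_sub (d hK₁)) (pd_diff hU hA 1 hp), pd_sub 0 (d hK₂) (d hK₁),
    hrel2 p hp, hrel1 p hp] at e2
  rw [hrel1 p hp]
  have a0 := hA0 p hp
  have b0 := hB0 p hp
  have ay := hAy p hp
  generalize pd 0 (pd 1 K₁) p = X at *
  have hX : X = ((K₂ p - K₁ p) * pd 0 (pd 1 A) p + pd 1 A p * ((K₁ p - K₂ p) * (pd 0 B p / B p)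
      - pd 0 K₁ p) - (K₂ p - K₁ p) * (pd 1 A p / A p) * pd 0 A p) / A p := by
    rw [eq_div_iff a0]
    linarith
  rw [hX]
  field_simp
  ring
end

section
/- Let n = 2 + p, let Ω ⊆ ℝⁿ be open with coordinates written (x, y, z¹, …, z^p), and let Γ^a_{bc} : Ω → ℝ be continuous functions symmetric in the lower indices (indices a,b,c range over {1,2} ∪ {2+1,…,2+p}, where index 1 corresponds to x, index 2 to y, and index 2+j to z^j). Let z^j : V → ℝ (V ⊆ ℝ² open) be continuously differentiable, and let s ↦ (x(s), y(s), w¹(s), …, w^p(s)) be a twice differentiable geodesic of Γ on an interval I with w^j(s) = z^j(x(s), y(s)) for all s ∈ I. Let s₀ ∈ I with ẋ(s₀) ≠ 0 and let u be a twice differentiable real function with y(s) = u(x(s)) in a neighborhood of s₀. Then at a = x(s₀), with all Γ and all partial derivatives z^j_x, z^j_y evaluated at the corresponding point (summation over repeated indices j,k ∈ {1,…,p} understood): u″ − [Γ¹₂₂ + 2Γ¹_{2j}z^j_y + Γ¹_{kj}z^k_y z^j_y]·u′³ + [Γ²₂₂ − 2Γ¹₁₂ + 2Γ²_{2j}z^j_y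 + Γ²_{kj}z^k_y z^j_y − 2Γ¹_{2j}z^j_x − 2Γ¹_{1j}z^j_y − Γ¹_{kj}(z^k_x z^j_y + z^k_y z^j_x)]·u′² + [2Γ²₁₂ − Γ¹₁₁ + 2Γ²_{2j}z^j_x + 2Γ²_{1j}z^j_y + Γ²_{kj}(z^k_x z^j_y + z^k_y z^j_x) − 2Γ¹_{1j}z^j_x − Γ¹_{kj}z^k_x z^j_x]·u′ + Γ²₁₁ + 2Γ²_{1j}z^j_x + Γ²_{kj}z^k_x z^j_x = 0. -/
theorem quad_expand (p : ℕ) (G : Fin (p + 2) → Fin (p + 2) → ℝ) (hG : ∀ b c, G b c = G c b)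
    (d : Fin (p + 2) → ℝ) (X P : ℝ) (zx zy : Fin p → ℝ) (h0 : d 0 = X) (h1 : d 1 = P * X)
    (hd : ∀ j : Fin p, d j.succ.succ = (zx j + P * zy j) * X) :
    ∑ b, ∑ c, G b c * d b * d c = X ^ 2 * (G 0 0 + 2 * G 0 1 * P + G 1 1 * P ^ 2
      + 2 * ∑ j, G 0 j.succ.succ * zx j + 2 * P * ∑ j, G 0 j.succ.succ * zy j
      + 2 * P * ∑ j, G 1 j.succ.succ * zx j + 2 * P ^ 2 * ∑ j, G 1 j.succ.succ * zy j
      + ∑ k, ∑ j, G k.succ.succ j.succ.succ * zx k * zx j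
      + P * ∑ k, ∑ j, G k.succ.succ j.succ.succ * (zx k * zy j + zy k * zx j)
      + P ^ 2 * ∑ k, ∑ j, G k.succ.succ j.succ.succ * zy k * zy j) := by
  have e0 : ∑ j : Fin p, G 0 j.succ.succ * d 0 * d j.succ.succ
      = X ^ 2 * (∑ j, G 0 j.succ.succ * zx j + P * ∑ j, G 0 j.succ.succ * zy j) := by
    simp only [Finset.mul_sum, ← Finset.sum_add_distrib]
    refine Finset.sum_congr rfl fun j _ => ?_
    rw [h0, hd]; ring
  have e1 : ∑ j : Fin p, G 1 j.succ.succ * d 1 * d j.succ.succ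
      = X ^ 2 * (P * ∑ j, G 1 j.succ.succ * zx j + P ^ 2 * ∑ j, G 1 j.succ.succ * zy j) := by
    simp only [Finset.mul_sum, ← Finset.sum_add_distrib]
    refine Finset.sum_congr rfl fun j _ => ?_
    rw [h1, hd]; ring
  have e2 : ∑ k : Fin p, ∑ j : Fin p, G k.succ.succ j.succ.succ * d k.succ.succ * d j.succ.succ
      = X ^ 2 * (∑ k, ∑ j, G k.succ.succ j.succ.succ * zx k * zx j
      + P * ∑ k, ∑ j, G k.succ.succ j.succ.succ * (zx k * zy j + zy k * zx j)
      + P ^ 2 * ∑ k, ∑ j, G k.succ.succ j.succ.succ * zy k * zy j) := by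
    simp only [Finset.mul_sum, ← Finset.sum_add_distrib]
    refine Finset.sum_congr rfl fun k _ => Finset.sum_congr rfl fun j _ => ?_
    rw [hd, hd]; ring
  have f0 : ∑ j : Fin p, G j.succ.succ 0 * d j.succ.succ * d 0
      = ∑ j : Fin p, G 0 j.succ.succ * d 0 * d j.succ.succ :=
    Finset.sum_congr rfl fun j _ => by rw [hG]; ring
  have f1 : ∑ j : Fin p, G j.succ.succ 1 * d j.succ.succ * d 1
      = ∑ j : Fin p, G 1 j.succ.succ * d 1 * d j.succ.succ :=
    Finset.sum_congr rfl fun j _ => by rw [hG]; ring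
  simp only [Fin.sum_univ_succ (n := p + 1), Fin.sum_univ_succ (n := p), Finset.sum_add_distrib,
    Fin.succ_zero_eq_one]
  rw [f0, f1, e0, e1, e2, h0, h1, hG 1 0]
  ring

/-- The correspondence between geodesics of an affine connection on an `(2+p)`-dimensional
space written over a two-dimensional surface `z^j = z^j(x,y)` and the second-order ODE
`y″ + a₁y′³ + 3a₂y′² + 3a₃y′ + a₄ = 0`.  Coordinates are indexed by `Fin (p+2)` with `0 ↦ x`,
`1 ↦ y` and `j.succ.succ ↦ z^j` for `j : Fin p`; `Γ a b c` denotes `Γ^a_{bc}`. -/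
theorem geodesic_on_surface_ode
    (p : ℕ) (Ω : Set (Fin (p + 2) → ℝ)) (hΩ : IsOpen Ω)
    (Γ : Fin (p + 2) → Fin (p + 2) → Fin (p + 2) → (Fin (p + 2) → ℝ) → ℝ)
    (hΓ : ∀ a b c, ContinuousOn (Γ a b c) Ω)
    (hsym : ∀ a b c, ∀ q ∈ Ω, Γ a b c q = Γ a c b q)
    (V : Set (ℝ × ℝ)) (hV : IsOpen V)
    (z : Fin p → ℝ × ℝ → ℝ) (hz : ∀ j, ContDiffOn ℝ 1 (z j) V)
    (I : Set ℝ) (γ : ℝ → (Fin (p + 2) → ℝ))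
    (hmem : ∀ s ∈ I, γ s ∈ Ω)
    (hmemV : ∀ s ∈ I, (γ s 0, γ s 1) ∈ V)
    (hγ : ∀ s ∈ I, ∀ a : Fin (p + 2), DifferentiableAt ℝ (fun t => γ t a) s ∧
      DifferentiableAt ℝ (fun t => deriv (fun t' => γ t' a) t) s)
    (hgeo : ∀ s ∈ I, ∀ a : Fin (p + 2),
      deriv (fun t => deriv (fun t' => γ t' a) t) s
        + ∑ b, ∑ c, Γ a b c (γ s) * deriv (fun t => γ t b) s * deriv (fun t => γ t c) s = 0)
    (hw : ∀ s ∈ I, ∀ j : Fin p, γ s j.succ.succ = z j (γ s 0, γ s 1))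
    (s₀ : ℝ) (hs₀ : s₀ ∈ I) (hx' : deriv (fun t => γ t 0) s₀ ≠ 0)
    (u : ℝ → ℝ) (hu : Differentiable ℝ u ∧ Differentiable ℝ (deriv u))
    (hyu : ∀ᶠ s in nhds s₀, s ∈ I ∧ γ s 1 = u (γ s 0)) :
    let a : ℝ := γ s₀ 0
    let q : Fin (p + 2) → ℝ := γ s₀
    let u' : ℝ := deriv u a
    let zx : Fin p → ℝ := fun j => fderiv ℝ (z j) (a, u a) (1, 0)
    let zy : Fin p → ℝ := fun j => fderiv ℝ (z j) (a, u a) (0, 1)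
    deriv (deriv u) a
      - (Γ 0 1 1 q + 2 * ∑ j, Γ 0 1 j.succ.succ q * zy j
          + ∑ k, ∑ j, Γ 0 k.succ.succ j.succ.succ q * zy k * zy j) * u' ^ 3
      + (Γ 1 1 1 q - 2 * Γ 0 0 1 q
          + 2 * ∑ j, Γ 1 1 j.succ.succ q * zy j
          + ∑ k, ∑ j, Γ 1 k.succ.succ j.succ.succ q * zy k * zy j
          - 2 * ∑ j, Γ 0 1 j.succ.succ q * zx j
          - 2 * ∑ j, Γ 0 0 j.succ.succ q * zy j
          - ∑ k, ∑ j, Γ 0 k.succ.succ j.succ.succ q * (zx k * zy j + zy k * zx j)) * u' ^ 2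
      + (2 * Γ 1 0 1 q - Γ 0 0 0 q
          + 2 * ∑ j, Γ 1 1 j.succ.succ q * zx j
          + 2 * ∑ j, Γ 1 0 j.succ.succ q * zy j
          + ∑ k, ∑ j, Γ 1 k.succ.succ j.succ.succ q * (zx k * zy j + zy k * zx j)
          - 2 * ∑ j, Γ 0 0 j.succ.succ q * zx j
          - ∑ k, ∑ j, Γ 0 k.succ.succ j.succ.succ q * zx k * zx j) * u'
      + Γ 1 0 0 q + 2 * ∑ j, Γ 1 0 j.succ.succ q * zx j
      + ∑ k, ∑ j, Γ 1 k.succ.succ j.succ.succ q * zx k * zx j = 0 := by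
  intro a q u' zx zy
  have hI := hγ s₀ hs₀
  have hya : γ s₀ 1 = u a := hyu.self_of_nhds.2
  set X := deriv (fun t => γ t 0) s₀ with hX
  have hx : HasDerivAt (fun t => γ t 0) X s₀ := (hI 0).1.hasDerivAt
  -- first derivative of y near s₀
  have hy1 : ∀ᶠ s in nhds s₀, deriv (fun t => γ t 1) s
      = deriv u (γ s 0) * deriv (fun t => γ t 0) s := by
    filter_upwards [hyu.eventually_nhds] with s hs
    have hsI : s ∈ I := hs.self_of_nhds.1
    have e : (fun t => γ t 1) =ᶠ[nhds s] fun t => u (γ t 0) := hs.mono fun t ht => ht.2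
    rw [e.deriv_eq]
    exact ((hu.1 (γ s 0)).hasDerivAt.comp s (hγ s hsI 0).1.hasDerivAt).deriv
  have hd1 : deriv (fun t => γ t 1) s₀ = u' * X := hy1.self_of_nhds
  have hy2 : deriv (fun t => deriv (fun t' => γ t' 1) t) s₀
      = deriv (deriv u) a * X * X + u' * deriv (fun t => deriv (fun t' => γ t' 0) t) s₀ := by
    have e : (fun t => deriv (fun t' => γ t' 1) t) =ᶠ[nhds s₀]
      fun s => deriv u (γ s 0) * deriv (fun t => γ t 0) s := hy1
    rw [e.deriv_eq]
    have h1 : HasDerivAt (fun s => deriv u (γ s 0)) (deriv (deriv u) a * X) s₀ :=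
      HasDerivAt.comp (h₂ := deriv u) (h := fun t => γ t 0) s₀ (hu.2 (γ s₀ 0)).hasDerivAt hx
    exact (h1.mul (hI 0).2.hasDerivAt).deriv
  have hdz : ∀ j : Fin p, deriv (fun t => γ t j.succ.succ) s₀ = (zx j + u' * zy j) * X := by
    intro j
    have e : (fun t => γ t j.succ.succ) =ᶠ[nhds s₀] fun t => z j (γ t 0, γ t 1) :=
      hyu.mono fun t ht => hw t ht.1 j
    rw [e.deriv_eq]
    have hzd : HasFDerivAt (z j) (fderiv ℝ (z j) (a, u a)) (γ s₀ 0, γ s₀ 1) := by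
      rw [hya]
      have hm : (a, u a) ∈ V := by rw [← hya]; exact hmemV s₀ hs₀
      exact (((hz j).differentiableOn (by norm_num)).differentiableAt
        (hV.mem_nhds hm)).hasFDerivAt
    have hp : HasDerivAt (fun t => (γ t 0, γ t 1)) (X, u' * X) s₀ := by
      have h1 := (hI 1).1.hasDerivAt
      rw [hd1] at h1
      exact hx.prodMk h1
    have h := (hzd.comp_hasDerivAt s₀ hp).deriv
    refine Eq.trans h ?_
    have : ((X, u' * X) : ℝ × ℝ) = X • ((1 : ℝ), (0 : ℝ)) + (u' * X) • ((0 : ℝ), (1 : ℝ)) := by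
      simp
    rw [this, map_add, map_smul, map_smul]
    simp only [smul_eq_mul, zx, zy]
    ring
  have hq : q ∈ Ω := hmem s₀ hs₀
  have g0 := hgeo s₀ hs₀ 0
  have g1 := hgeo s₀ hs₀ 1
  rw [quad_expand p (fun b c => Γ 0 b c q) (fun b c => hsym 0 b c q hq)
    (fun b => deriv (fun t => γ t b) s₀) X u' zx zy rfl hd1 hdz] at g0
  rw [quad_expand p (fun b c => Γ 1 b c q) (fun b c => hsym 1 b c q hq)
    (fun b => deriv (fun t => γ t b) s₀) X u' zx zy rfl hd1 hdz, hy2] at g1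
  have hX2 : X ^ 2 ≠ 0 := pow_ne_zero 2 hx'
  apply mul_left_cancel₀ hX2
  linear_combination g1 - u' * g0
end

section
/- Let Ω ⊆ ℝ² be open and let Θ : Ω → M_n(ℝ) be a twice continuously differentiable matrix-valued function with Θ(p) invertible for every p ∈ Ω, satisfying the compatible system Θ_{xy} = Θ_x·Θ⁻¹·Θ_y + Θ_y·Θ⁻¹·Θ_x and Θ_{yy} = 2·Θ_y·Θ⁻¹·Θ_y on Ω. Then the matrices C := Θ_y·Θ⁻¹ and D := Θ_x·Θ⁻¹ satisfy on Ω: (i) C_x − 2D_y + 2CD − DC = 0; (ii) D_y − 2C_x + 2DC − CD = 0; (iii) C_y = C²; (iv) C_x − D_y + CD − DC = 0. -/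
/-- Entrywise partial derivative in the `x`-direction of a matrix-valued function on `ℝ²`. -/
noncomputable def pmx (n : ℕ) (Θ : ℝ × ℝ → Matrix (Fin n) (Fin n) ℝ) :
    ℝ × ℝ → Matrix (Fin n) (Fin n) ℝ :=
  fun p => Matrix.of fun i j => fderiv ℝ (fun q => Θ q i j) p (1, 0)

/-- Entrywise partial derivative in the `y`-direction of a matrix-valued function on `ℝ²`. -/
noncomputable def pmy (n : ℕ) (Θ : ℝ × ℝ → Matrix (Fin n) (Fin n) ℝ) :
    ℝ × ℝ → Matrix (Fin n) (Fin n) ℝ :=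
  fun p => Matrix.of fun i j => fderiv ℝ (fun q => Θ q i j) p (0, 1)

/-- Directional derivative, entrywise. -/
noncomputable def pdv (n : ℕ) (v : ℝ × ℝ) (A : ℝ × ℝ → Matrix (Fin n) (Fin n) ℝ) :
    ℝ × ℝ → Matrix (Fin n) (Fin n) ℝ :=
  fun p => Matrix.of fun i j => fderiv ℝ (fun q => A q i j) p v

lemma pmx_eq_pdv (n : ℕ) : pmx n = pdv n (1, 0) := rfl
lemma pmy_eq_pdv (n : ℕ) : pmy n = pdv n (0, 1) := rfl

lemma diff_det (n : ℕ) (A : ℝ × ℝ → Matrix (Fin n) (Fin n) ℝ) (p : ℝ × ℝ)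
    (hA : ∀ i j, DifferentiableAt ℝ (fun q => A q i j) p) :
    DifferentiableAt ℝ (fun q => (A q).det) p := by
  simp only [Matrix.det_apply']
  refine DifferentiableAt.fun_sum fun σ _ => ?_
  refine DifferentiableAt.const_mul ?_ _
  exact (HasFDerivAt.finsetProd (g := fun i q => A q (σ i) i)
    fun i _ => (hA (σ i) i).hasFDerivAt).differentiableAt

lemma diff_mul (n : ℕ) (A B : ℝ × ℝ → Matrix (Fin n) (Fin n) ℝ) (p : ℝ × ℝ)
    (hA : ∀ i j, DifferentiableAt ℝ (fun q => A q i j) p)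
    (hB : ∀ i j, DifferentiableAt ℝ (fun q => B q i j) p) (i j : Fin n) :
    DifferentiableAt ℝ (fun q => (A q * B q) i j) p := by
  simp only [Matrix.mul_apply]
  exact DifferentiableAt.fun_sum fun k _ => (hA _ _).mul (hB _ _)

lemma diff_inv (n : ℕ) (A : ℝ × ℝ → Matrix (Fin n) (Fin n) ℝ) (p : ℝ × ℝ)
    (hA : ∀ i j, DifferentiableAt ℝ (fun q => A q i j) p) (hu : IsUnit (A p)) (i j : Fin n) :
    DifferentiableAt ℝ (fun q => (A q)⁻¹ i j) p := by
  simp only [Matrix.inv_def, Ring.inverse_eq_inv', Matrix.smul_apply, smul_eq_mul,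
    Matrix.adjugate_apply]
  refine DifferentiableAt.mul (DifferentiableAt.inv (diff_det n A p hA) ?_) ?_
  · exact ((Matrix.isUnit_iff_isUnit_det _).1 hu).ne_zero
  · refine diff_det n (fun q => (A q).updateRow j (Pi.single i 1)) p fun k l => ?_
    simp only [Matrix.updateRow_apply]
    split_ifs
    · exact differentiableAt_const _
    · exact hA _ _

lemma pdv_mul (n : ℕ) (v : ℝ × ℝ) (A B : ℝ × ℝ → Matrix (Fin n) (Fin n) ℝ) (p : ℝ × ℝ)
    (hA : ∀ i j, DifferentiableAt ℝ (fun q => A q i j) p)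
    (hB : ∀ i j, DifferentiableAt ℝ (fun q => B q i j) p) :
    pdv n v (fun q => A q * B q) p = pdv n v A p * B p + A p * pdv n v B p := by
  ext i j
  simp only [pdv, Matrix.of_apply, Matrix.mul_apply, Matrix.add_apply]
  rw [fderiv_fun_sum (A := fun k q => A q i k * B q k j) fun k _ => (hA i k).mul (hB k j)]
  simp only [ContinuousLinearMap.sum_apply, ← Finset.sum_add_distrib]
  refine Finset.sum_congr rfl fun k _ => ?_
  rw [fderiv_fun_mul (hA _ _) (hB _ _)]
  simp only [ContinuousLinearMap.add_apply, ContinuousLinearMap.smul_apply, smul_eq_mul]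
  ring

lemma pdv_congr (n : ℕ) (v : ℝ × ℝ) (A B : ℝ × ℝ → Matrix (Fin n) (Fin n) ℝ) (p : ℝ × ℝ)
    (h : A =ᶠ[nhds p] B) : pdv n v A p = pdv n v B p := by
  ext i j
  simp only [pdv, Matrix.of_apply]
  have h' : (fun q => A q i j) =ᶠ[nhds p] fun q => B q i j :=
    h.mono fun q hq => by simp only [hq]
  rw [h'.fderiv_eq]

/-- Derivative of a logarithmic derivative. -/
lemma pdv_log (n : ℕ) (Ω : Set (ℝ × ℝ)) (hΩ : IsOpen Ω)
    (Θ : ℝ × ℝ → Matrix (Fin n) (Fin n) ℝ)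
    (hΘ : ∀ i j, ContDiffOn ℝ 2 (fun q => Θ q i j) Ω)
    (hinv : ∀ p ∈ Ω, IsUnit (Θ p)) (v w : ℝ × ℝ) (p : ℝ × ℝ) (hp : p ∈ Ω) :
    pdv n v (fun q => pdv n w Θ q * (Θ q)⁻¹) p = pdv n v (pdv n w Θ) p * (Θ p)⁻¹
      - (pdv n w Θ p * (Θ p)⁻¹) * (pdv n v Θ p * (Θ p)⁻¹) := by
  have hc : ∀ i j, ContDiffAt ℝ 2 (fun q => Θ q i j) p :=
    fun i j => (hΘ i j).contDiffAt (hΩ.mem_nhds hp)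
  have h1 : ∀ i j, DifferentiableAt ℝ (fun q => Θ q i j) p :=
    fun i j => (hc i j).differentiableAt (by norm_num)
  have h2 : ∀ i j, DifferentiableAt ℝ (fun q => pdv n w Θ q i j) p := fun i j => by
    have := ((hc i j).fderiv_right (m := 1) (by norm_num)).differentiableAt (by norm_num)
    exact this.clm_apply (differentiableAt_const w)
  have h3 := diff_inv n Θ p h1 (hinv p hp)
  have h4 := diff_mul n _ _ p h2 h3
  have hm := pdv_mul n v _ _ p h4 h1
  have he : (fun q => pdv n w Θ q * (Θ q)⁻¹ * Θ q) =ᶠ[nhds p] pdv n w Θ := by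
    filter_upwards [hΩ.mem_nhds hp] with q hq
    rw [Matrix.mul_assoc, Matrix.nonsing_inv_mul _ ((Matrix.isUnit_iff_isUnit_det _).1 (hinv q hq)),
      Matrix.mul_one]
  rw [pdv_congr n v _ _ p he] at hm
  rw [hm, Matrix.add_mul, Matrix.mul_assoc _ (Θ p),
    Matrix.mul_nonsing_inv _ ((Matrix.isUnit_iff_isUnit_det _).1 (hinv p hp)), Matrix.mul_one]
  simp only [Matrix.mul_assoc, add_sub_cancel_right]

lemma pdv_comm (n : ℕ) (Θ : ℝ × ℝ → Matrix (Fin n) (Fin n) ℝ) (v w p : ℝ × ℝ)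
    (hc : ∀ i j, ContDiffAt ℝ 2 (fun q => Θ q i j) p) :
    pdv n v (pdv n w Θ) p = pdv n w (pdv n v Θ) p := by
  ext i j
  have hd := ((hc i j).fderiv_right (m := 1) (by norm_num)).differentiableAt (by norm_num)
  have hs := (hc i j).isSymmSndFDerivAt (by simp)
  simp only [pdv, Matrix.of_apply]
  rw [fderiv_clm_apply hd (differentiableAt_const w),
    fderiv_clm_apply hd (differentiableAt_const v)]
  simpa using hs v w

/-- If the invertible `C²` matrix function `Θ(x,y)` satisfies
`Θ_{xy} = Θ_x Θ⁻¹ Θ_y + Θ_y Θ⁻¹ Θ_x` and `Θ_{yy} = 2 Θ_y Θ⁻¹ Θ_y`, then `C = Θ_y Θ⁻¹` and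
`D = Θ_x Θ⁻¹` satisfy `C_x − 2D_y + 2CD − DC = 0`, `D_y − 2C_x + 2DC − CD = 0`, `C_y = C²`
and `C_x − D_y + CD − DC = 0`. -/
theorem theta_system_compatibility
    (n : ℕ) (Ω : Set (ℝ × ℝ)) (hΩ : IsOpen Ω)
    (Θ : ℝ × ℝ → Matrix (Fin n) (Fin n) ℝ)
    (hΘ : ∀ i j, ContDiffOn ℝ 2 (fun q => Θ q i j) Ω)
    (hinv : ∀ p ∈ Ω, IsUnit (Θ p))
    (hxy : ∀ p ∈ Ω, pmx n (pmy n Θ) p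
      = pmx n Θ p * (Θ p)⁻¹ * pmy n Θ p + pmy n Θ p * (Θ p)⁻¹ * pmx n Θ p)
    (hyy : ∀ p ∈ Ω, pmy n (pmy n Θ) p
      = (2 : ℝ) • (pmy n Θ p * (Θ p)⁻¹ * pmy n Θ p)) :
    let C : ℝ × ℝ → Matrix (Fin n) (Fin n) ℝ := fun q => pmy n Θ q * (Θ q)⁻¹
    let D : ℝ × ℝ → Matrix (Fin n) (Fin n) ℝ := fun q => pmx n Θ q * (Θ q)⁻¹
    ∀ p ∈ Ω,
      (pmx n C p - (2 : ℝ) • pmy n D p + (2 : ℝ) • (C p * D p) - D p * C p = 0) ∧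
      (pmy n D p - (2 : ℝ) • pmx n C p + (2 : ℝ) • (D p * C p) - C p * D p = 0) ∧
      (pmy n C p = C p * C p) ∧
      (pmx n C p - pmy n D p + C p * D p - D p * C p = 0) := by
  intro C D p hp
  have hCx := pdv_log n Ω hΩ Θ hΘ hinv (1, 0) (0, 1) p hp
  have hCy := pdv_log n Ω hΩ Θ hΘ hinv (0, 1) (0, 1) p hp
  have hDy := pdv_log n Ω hΩ Θ hΘ hinv (0, 1) (1, 0) p hp
  rw [pdv_comm n Θ (0, 1) (1, 0) p fun i j => (hΘ i j).contDiffAt (hΩ.mem_nhds hp)] at hDy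
  simp only [← pmx_eq_pdv, ← pmy_eq_pdv] at hCx hCy hDy
  rw [hxy p hp] at hCx hDy
  rw [hyy p hp] at hCy
  have eCx : pmx n C p = D p * C p := by
    refine hCx.trans ?_
    simp only [C, D]
    noncomm_ring
  have eDy : pmy n D p = C p * D p := by
    refine hDy.trans ?_
    simp only [C, D]
    noncomm_ring
  have eCy : pmy n C p = C p * C p := by
    refine hCy.trans ?_
    simp only [C, two_smul]
    noncomm_ring
  rw [eCx, eDy]
  refine ⟨?_, ?_, eCy, ?_⟩
  · simp
  · simp
  · simp
end
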